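/- Let n ≥ 3 be an integer and 𝔇 > 1 a real number. Set q = ⌊n/2⌋, t = ⌈n/2⌉, and let X = {a_1,…,a_q,b_1,…,b_t} be an n-point set with the semi-metric d given by d(a_j,b_i) = 1 for all i,j, all distances within {a_1,…,a_q} and within {b_1,…,b_t} equal to 𝔇, and d(x,x) = 0. Then (X,d) has p-negative type if and only if 0 ≤ p ≤ ζ(n,𝔇) = ln(1/(1−Γ))/ln 𝔇, where Γ = (1/2)(1/⌊n/2⌋ + 1/⌈n/2⌉). In particular, for every n ≥ 3 and every 𝔇 > 1 there is an n-point semi-metric space of scaled diameter 𝔇 whose maximal p-negative type is exactly ζ(n,𝔇). -/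

import Mathlib

/-- The distance function of the complete bipartite example: parts `Fin q` and `Fin t`,
distance `1` across the parts and `c` within each part. -/
def bipartiteDist (q t : ℕ) (c : ℝ) : Fin q ⊕ Fin t → Fin q ⊕ Fin t → ℝ := fun x y =>
  if x = y then 0 else
    match x, y with
    | Sum.inl _, Sum.inr _ => 1
    | Sum.inr _, Sum.inl _ => 1
    | Sum.inl _, Sum.inl _ => c
    | Sum.inr _, Sum.inr _ => c

open Finset in
/-- The `p`-energy of a weight on the bipartite space, in terms of the sums and the sums of
squares over the two parts. -/
theorem bipartiteDist_energy (q t : ℕ) (c p : ℝ) (w : Fin q ⊕ Fin t → ℝ) :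
    ∑ x, ∑ y, (if x = y then 0 else bipartiteDist q t c x y ^ p * (w x * w y)) =
      c ^ p * ((∑ i, w (Sum.inl i)) ^ 2 - ∑ i, w (Sum.inl i) ^ 2) +
      c ^ p * ((∑ i, w (Sum.inr i)) ^ 2 - ∑ i, w (Sum.inr i) ^ 2) +
      2 * ((∑ i, w (Sum.inl i)) * ∑ i, w (Sum.inr i)) := by
  have part : ∀ (m : ℕ) (u : Fin m → ℝ),
      ∑ i, ∑ j, (if i = j then 0 else c ^ p * (u i * u j)) =
        c ^ p * ((∑ i, u i) ^ 2 - ∑ i, u i ^ 2) := by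
    intro m u
    have inner : ∀ i, ∑ j, (if i = j then 0 else c ^ p * (u i * u j)) =
        ∑ j, c ^ p * (u i * u j) - c ^ p * u i ^ 2 := by
      intro i
      have split : ∀ j, (if i = j then 0 else c ^ p * (u i * u j)) =
          c ^ p * (u i * u j) - if i = j then c ^ p * (u i * u j) else 0 := by
        intro j; split_ifs <;> ring
      simp_rw [split, sum_sub_distrib, sum_ite_eq, mem_univ, if_true]
      ring
    simp_rw [inner, sum_sub_distrib, sq (∑ i, u i), sum_mul_sum, mul_sub, mul_sum]
  have left := part q fun i => w (Sum.inl i)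
  have right := part t fun i => w (Sum.inr i)
  have cross : ∑ i, ∑ j, w (Sum.inl i) * w (Sum.inr j) =
      (∑ i, w (Sum.inl i)) * ∑ j, w (Sum.inr j) := by
    rw [sum_mul_sum]
  have cross_symm : ∑ j, ∑ i, w (Sum.inr j) * w (Sum.inl i) =
      (∑ i, w (Sum.inl i)) * ∑ j, w (Sum.inr j) := by
    rw [← sum_mul_sum, mul_comm]
  rw [← left, ← right, two_mul]
  nth_rewrite 1 [← cross]
  rw [← cross_symm]
  simp only [Fintype.sum_sum_type, sum_add_distrib, reduceCtorEq, if_false, Sum.inl.injEq,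
    Sum.inr.injEq, bipartiteDist, Real.one_rpow, one_mul]
  have drop : ∀ (m : ℕ) (u : Fin m → ℝ),
      ∑ i, ∑ j, (if i = j then 0 else (if i = j then 0 else c) ^ p * (u i * u j)) =
        ∑ i, ∑ j, (if i = j then 0 else c ^ p * (u i * u j)) := by
    intro m u
    refine sum_congr rfl fun i _ => sum_congr rfl fun j _ => ?_
    split_ifs <;> rfl
  rw [drop q fun i => w (Sum.inl i), drop t fun i => w (Sum.inr i)]
  ring

/-- Negative type of a finite space can be tested on weights carried by the whole space. -/
theorem negativeType_iff_sum_univ {X : Type*} [Fintype X] [DecidableEq X]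
    (hX : 2 ≤ Fintype.card X) (K : X → X → ℝ) :
    (∀ k : ℕ, 2 ≤ k → ∀ x : Fin k → X, Function.Injective x → ∀ η : Fin k → ℝ, ∑ l, η l = 0 →
        ∑ i, ∑ j, (if i = j then 0 else K (x i) (x j) * (η i * η j)) ≤ 0) ↔
      ∀ w : X → ℝ, ∑ a, w a = 0 →
        ∑ a, ∑ b, (if a = b then 0 else K a b * (w a * w b)) ≤ 0 := by
  constructor
  · intro h w hw
    let e := (Fintype.equivFin X).symm
    have key := h _ hX e e.injective (fun i => w (e i)) (by rw [e.sum_comp w, hw])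
    have reindex : ∑ i, ∑ j, (if i = j then 0 else K (e i) (e j) * (w (e i) * w (e j))) =
        ∑ a, ∑ b, (if a = b then 0 else K a b * (w a * w b)) := by
      rw [← e.sum_comp]
      refine Finset.sum_congr rfl fun i _ => ?_
      rw [← e.sum_comp]
      simp only [e.injective.eq_iff]
    exact reindex ▸ key
  · intro h k _ x hx η hη
    have w_apply : ∀ i, Function.extend x η 0 (x i) = η i := fun i => hx.extend_apply η _ i
    have w_off : ∀ a, a ∉ Set.range x → Function.extend x η 0 a = 0 := fun a ha =>
      Function.extend_apply' η _ a ha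
    have sum_w : ∑ a, Function.extend x η 0 a = 0 := by
      rw [← hη]
      exact (Fintype.sum_of_injective x hx _ _ w_off fun i => (w_apply i).symm).symm
    refine le_of_eq_of_le ?_ (h (Function.extend x η 0) sum_w)
    refine Fintype.sum_of_injective x hx _ _ ?_ fun i => ?_
    · intro a ha
      simp [w_off a ha]
    · refine Fintype.sum_of_injective x hx _ _ ?_ fun j => ?_
      · intro b hb
        simp [w_off b hb]
      · simp only [w_apply, hx.eq_iff]

/-- The bipartite space has `p`-negative type exactly when `c ^ p * (1 - Γ) ≤ 1`, where
`Γ = 1 / 2 * (1 / q + 1 / t)`. -/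
theorem bipartiteDist_negativeType_iff {q t : ℕ} (hq : 0 < q) (ht : 0 < t) {c p : ℝ}
    (hc : 0 < c) :
    (∀ w : Fin q ⊕ Fin t → ℝ, ∑ a, w a = 0 →
        ∑ a, ∑ b, (if a = b then 0 else bipartiteDist q t c a b ^ p * (w a * w b)) ≤ 0) ↔
      c ^ p * (1 - 1 / 2 * (1 / (q : ℝ) + 1 / (t : ℝ))) ≤ 1 := by
  have hq' : (0 : ℝ) < q := by exact_mod_cast hq
  have ht' : (0 : ℝ) < t := by exact_mod_cast ht
  have hcp : 0 < c ^ p := Real.rpow_pos_of_pos hc p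
  simp_rw [bipartiteDist_energy]
  simp only [Fintype.sum_sum_type]
  constructor
  · intro h
    have key := h (Sum.elim (fun _ => 1 / (q : ℝ)) fun _ => -(1 / (t : ℝ)))
      (by simp [hq'.ne', ht'.ne'])
    simp only [Sum.elim_inl, Sum.elim_inr, Finset.sum_const, Finset.card_univ, Fintype.card_fin,
      nsmul_eq_mul] at key
    have simplify : c ^ p * (((q : ℝ) * (1 / q)) ^ 2 - q * (1 / (q : ℝ)) ^ 2) +
        c ^ p * (((t : ℝ) * -(1 / t)) ^ 2 - t * (-(1 / (t : ℝ))) ^ 2) +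
        2 * ((q : ℝ) * (1 / q) * (t * -(1 / (t : ℝ)))) =
        2 * (c ^ p * (1 - 1 / 2 * (1 / (q : ℝ) + 1 / (t : ℝ))) - 1) := by
      field_simp
      ring
    linarith
  · intro h w hw
    have cauchy : ∀ (m : ℕ), (0 : ℝ) < m → ∀ u : Fin m → ℝ,
        (∑ i, u i) ^ 2 * (1 / (m : ℝ)) ≤ ∑ i, u i ^ 2 := by
      intro m hm u
      have := sq_sum_le_card_mul_sum_sq (s := Finset.univ) (f := u)
      rw [Finset.card_univ, Fintype.card_fin] at this
      rw [mul_one_div, div_le_iff₀ hm]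
      linarith
    have left := mul_le_mul_of_nonneg_left (cauchy q hq' fun i => w (Sum.inl i)) hcp.le
    have right := mul_le_mul_of_nonneg_left (cauchy t ht' fun i => w (Sum.inr i)) hcp.le
    rw [eq_neg_of_add_eq_zero_right hw] at right ⊢
    have scaled := mul_le_mul_of_nonneg_left h (sq_nonneg (∑ i, w (Sum.inl i)))
    linarith

/-- Remarks 4.2/4.3 for semi-metric spaces: for `n ≥ 3`, `𝔇 > 1`,
`q = ⌊n/2⌋`, `t = ⌈n/2⌉`, the distance on the `n`-point set `{a_1,…,a_q,b_1,…,b_t}` with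
`d(a_j,b_i) = 1` and all distances within each part equal to `𝔇` is a semi-metric of
scaled diameter `𝔇`, and the resulting space has `p`-negative type if and only if
`0 ≤ p ≤ ζ(n,𝔇) = ln(1/(1−Γ))/ln 𝔇`, where `Γ = (1/2)(1/⌊n/2⌋ + 1/⌈n/2⌉)`.  In
particular its maximal `p`-negative type is exactly `ζ(n,𝔇)`. -/
theorem bipartite_semimetric_example (n : ℕ) (hn : 3 ≤ n) (𝔇 : ℝ) (h𝔇1 : 1 < 𝔇)
    (d : Fin (n / 2) ⊕ Fin ((n + 1) / 2) → Fin (n / 2) ⊕ Fin ((n + 1) / 2) → ℝ)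
    (hd : d = bipartiteDist (n / 2) ((n + 1) / 2) 𝔇)
    (Γ ζ : ℝ)
    (hΓ : Γ = 1 / 2 * (1 / ((n / 2 : ℕ) : ℝ) + 1 / (((n + 1) / 2 : ℕ) : ℝ)))
    (hζ : ζ = Real.log (1 / (1 - Γ)) / Real.log 𝔇) :
    ((∀ x, d x x = 0) ∧ (∀ x y, d x y = d y x) ∧ (∀ x y, x ≠ y → 0 < d x y)) ∧
    (∃ Dmax Dmin : ℝ,
      IsGreatest {r : ℝ | ∃ x y, r = d x y} Dmax ∧
      IsLeast {r : ℝ | ∃ x y, x ≠ y ∧ r = d x y} Dmin ∧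
      Dmax / Dmin = 𝔇) ∧
    (∀ p : ℝ, 0 ≤ p →
      ((∀ (k : ℕ), 2 ≤ k →
          ∀ x : Fin k → Fin (n / 2) ⊕ Fin ((n + 1) / 2), Function.Injective x →
            ∀ η : Fin k → ℝ, (∑ l, η l = 0) →
              ∑ i, ∑ j, (if i = j then 0 else d (x i) (x j) ^ p * (η i * η j)) ≤ 0) ↔
        p ≤ ζ)) := by
  have hq : 0 < n / 2 := by omega
  have ht : 1 < (n + 1) / 2 := by omega
  have hcard : 2 ≤ Fintype.card (Fin (n / 2) ⊕ Fin ((n + 1) / 2)) := by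
    simp only [Fintype.card_sum, Fintype.card_fin]
    omega
  have hΓ1 : 0 < 1 - Γ := by
    have hq' : (1 : ℝ) ≤ ((n / 2 : ℕ) : ℝ) := by exact_mod_cast hq
    have ht' : (2 : ℝ) ≤ (((n + 1) / 2 : ℕ) : ℝ) := by exact_mod_cast ht
    have inv_q : 1 / ((n / 2 : ℕ) : ℝ) ≤ 1 / 1 := one_div_le_one_div_of_le one_pos hq'
    have inv_t : 1 / (((n + 1) / 2 : ℕ) : ℝ) ≤ 1 / 2 := one_div_le_one_div_of_le two_pos ht'
    linarith
  have h𝔇 : 0 < 𝔇 := one_pos.trans h𝔇1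
  have hlog : 0 < Real.log 𝔇 := Real.log_pos h𝔇1
  let a : Fin (n / 2) := ⟨0, hq⟩
  let b : Fin ((n + 1) / 2) := ⟨0, by omega⟩
  let b' : Fin ((n + 1) / 2) := ⟨1, ht⟩
  have hb : b ≠ b' := by simp [b, b']
  subst hd
  refine ⟨⟨?_, ?_, ?_⟩, ⟨𝔇, 1, ⟨?_, ?_⟩, ⟨?_, ?_⟩, div_one 𝔇⟩, ?_⟩
  · intro x
    simp [bipartiteDist]
  · rintro (x | x) (y | y) <;> simp [bipartiteDist, eq_comm]
  · rintro (x | x) (y | y) hxy <;> simp_all [bipartiteDist]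
  · exact ⟨Sum.inr b, Sum.inr b', by simp [bipartiteDist, hb]⟩
  · rintro r ⟨x | x, y | y, rfl⟩ <;> simp only [bipartiteDist] <;> split_ifs <;> linarith
  · exact ⟨Sum.inl a, Sum.inr b, by simp, by simp [bipartiteDist]⟩
  · rintro r ⟨x | x, y | y, hxy, rfl⟩ <;> simp only [bipartiteDist, if_neg hxy] <;> linarith
  · intro p _
    rw [negativeType_iff_sum_univ hcard fun x y => bipartiteDist (n / 2) ((n + 1) / 2) 𝔇 x y ^ p,
      bipartiteDist_negativeType_iff hq (by omega) h𝔇, ← hΓ, hζ, le_div_iff₀ hlog,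
      ← le_div_iff₀ hΓ1, ← Real.log_rpow h𝔇,
      Real.log_le_log_iff (Real.rpow_pos_of_pos h𝔇 p) (one_div_pos.mpr hΓ1)]
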